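/- arXiv:1109.0906 — 4 statements merged into one kernel-verified Lean document; each statement's English description precedes it below -/
import Mathlib

section
/- Let (W, S) be a Coxeter system whose set S of simple reflections is finite. Then every solvable subgroup of W is finitely generated. -/
theorem Group.fg_of_fg_ker_of_fg_range {G Q : Type*} [Group G] [Group Q] (f : G →* Q)
    (hk : Group.FG f.ker) (hr : Group.FG f.range) : Group.FG G := by
  rw [Group.fg_iff_subgroup_fg] at hk hr
  obtain ⟨S, hS⟩ := hr
  classical
  have hSr : (S : Set Q) ⊆ f '' Set.univ := fun x hx => by
    have : x ∈ f.range := hS ▸ Subgroup.subset_closure hx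
    simpa using this
  obtain ⟨T, -, rfl⟩ := Finset.subset_set_image_iff.1 hSr
  have hfg : (Subgroup.closure (T : Set G) ⊔ f.ker).FG := Subgroup.FG.sup ⟨T, rfl⟩ hk
  have htop : Subgroup.closure (T : Set G) ⊔ f.ker = ⊤ := by
    rw [← Subgroup.comap_map_eq, MonoidHom.map_closure, ← Finset.coe_image, hS]
    ext x; simp
  exact ⟨htop ▸ hfg⟩

theorem Group.fg_of_finiteIndex {G : Type*} [Group G] (H : Subgroup G) [H.FiniteIndex]
    [hH : Group.FG H] : Group.FG G := by
  rw [Group.fg_iff_subgroup_fg] at hH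
  let T : Set G := Set.range (Quotient.out : G ⧸ H → G)
  have hT : T.Finite := @Set.finite_range _ _ _ (inferInstanceAs (Finite (G ⧸ H)))
  have hfg : (Subgroup.closure T ⊔ H).FG :=
    Subgroup.FG.sup ⟨hT.toFinset, by simp⟩ hH
  have htop : Subgroup.closure T ⊔ H = ⊤ := by
    refine (Subgroup.eq_top_iff' _).2 fun g => ?_
    have h1 : (Quotient.out (g : G ⧸ H))⁻¹ * g ∈ H :=
      QuotientGroup.eq.1 (Quotient.out_eq (g : G ⧸ H))
    have h2 : Quotient.out (g : G ⧸ H) ∈ Subgroup.closure T :=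
      Subgroup.subset_closure ⟨_, rfl⟩
    simpa using Subgroup.mul_mem_sup h2 h1
  exact ⟨htop ▸ hfg⟩

theorem Group.fg_of_injective_of_comm {G C : Type*} [Group G] [CommGroup C] [Group.FG C]
    (f : G →* C) (hf : Function.Injective f) : Group.FG G := by
  have : Module.Finite ℤ (Additive C) := Module.Finite.iff_addGroup_fg.2 inferInstance
  have h : (AddSubgroup.toIntSubmodule (Subgroup.toAddSubgroup f.range)).FG :=
    IsNoetherian.noetherian _
  have h2 : Group.FG f.range := by
    rw [Group.fg_iff_subgroup_fg, Subgroup.fg_iff_add_fg]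
    exact Submodule.fg_iff_addSubgroup_fg _ |>.1 h
  exact Group.fg_of_surjective (f := (MonoidHom.ofInjective hf).symm.toMonoidHom)
    (MonoidHom.ofInjective hf).symm.surjective

theorem Subgroup.finiteIndex_of_finite_range {G α : Type*} [Group G] (H : Subgroup G) (φ : G → α)
    (hφ : (Set.range φ).Finite) (h : ∀ a b, φ a = φ b → a⁻¹ * b ∈ H) : H.FiniteIndex := by
  have := hφ.to_subtype
  have : Finite (G ⧸ H) := by
    refine Finite.of_injective
      (fun q : G ⧸ H => (⟨φ q.out, q.out, rfl⟩ : Set.range φ)) fun p q hpq => ?_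
    rw [← Quotient.out_eq p, ← Quotient.out_eq q]
    exact QuotientGroup.eq.2 (h _ _ (congrArg Subtype.val hpq))
  exact Subgroup.finiteIndex_of_finite_quotient

namespace Module.End

variable {F V : Type*} [Field F] [IsAlgClosed F] [AddCommGroup V] [Module F V]
  [FiniteDimensional F V]

theorem exists_forall_apply_eq_smul_of_commute [Nontrivial V] {ι : Type*} (f : ι → Module.End F V)
    (hf : ∀ i j, Commute (f i) (f j)) :
    ∃ (χ : ι → F) (v : V), v ≠ 0 ∧ ∀ i, f i v = χ i • v := by
  induction h : Module.finrank F V using Nat.strong_induction_on generalizing V with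
  | _ n ih =>
  by_cases hs : ∀ i, ∃ c : F, ∀ v, f i v = c • v
  · choose χ hχ using hs
    obtain ⟨v, hv⟩ := exists_ne (0 : V)
    exact ⟨χ, v, hv, fun i => hχ i v⟩
  · push Not at hs
    obtain ⟨i, hi⟩ := hs
    obtain ⟨c, hc⟩ := Module.End.exists_eigenvalue (f i)
    let E := (f i).eigenspace c
    have hE : ∀ j, ∀ x ∈ E, f j x ∈ E := fun j x hx => by
      rw [Module.End.mem_eigenspace_iff] at hx ⊢
      have := LinearMap.congr_fun (hf i j) x
      simp only [Module.End.mul_apply] at this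
      rw [this, hx, map_smul]
    have hlt : Module.finrank F E < n := by
      rw [← h]
      refine Submodule.finrank_lt fun htop => ?_
      obtain ⟨v, hv⟩ := hi c
      exact hv (Module.End.mem_eigenspace_iff.1 (show v ∈ E from htop ▸ Submodule.mem_top))
    have : Nontrivial E := Submodule.nontrivial_iff_ne_bot.2 hc
    obtain ⟨χ, v, hv, hχ⟩ := ih _ hlt (V := E) (fun j => (f j).restrict (hE j))
      (fun j k => by
        ext x
        have := LinearMap.congr_fun (hf j k) x
        simpa using this) rfl
    exact ⟨χ, v, by simpa using hv, fun j => by simpa using congrArg Subtype.val (hχ j)⟩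

end Module.End

namespace Representation

variable {F V G : Type*} [Field F] [AddCommGroup V] [Module F V] [Group G]

/-- A representation is strongly irreducible if its restriction to every subgroup of finite index
has no nontrivial invariant subspace. -/
def IsStronglyIrreducible (ρ : Representation F G V) : Prop :=
  ∀ (H : Subgroup G) [H.FiniteIndex] (W : Submodule F V),
    (∀ h ∈ H, ∀ w ∈ W, ρ h w ∈ W) → W = ⊥ ∨ W = ⊤

theorem commute_iff_conj_eq {ρ : Representation F G V} {g : G} {x : Module.End F V} :
    Commute (ρ g) x ↔ ρ g * x * ρ g⁻¹ = x := by
  have h1 : ρ g * ρ g⁻¹ = 1 := by rw [← map_mul]; simp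
  have h2 : ρ g⁻¹ * ρ g = 1 := by rw [← map_mul]; simp
  constructor
  · intro h
    rw [h.eq, mul_assoc, h1, mul_one]
  · intro h
    rw [Commute, SemiconjBy]
    nth_rewrite 2 [← h]
    rw [mul_assoc, h2, mul_one]

theorem commute_of_conj_eq {ρ : Representation F G V} {a b : G} {x : Module.End F V}
    (hab : ρ a * x * ρ a⁻¹ = ρ b * x * ρ b⁻¹) : Commute (ρ (a⁻¹ * b)) x := by
  rw [commute_iff_conj_eq]
  have h2 : ρ a⁻¹ * ρ a = 1 := by rw [← map_mul]; simp
  calc ρ (a⁻¹ * b) * x * ρ (a⁻¹ * b)⁻¹ = ρ a⁻¹ * (ρ b * x * ρ b⁻¹) * ρ a := by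
        simp [mul_assoc]
    _ = ρ a⁻¹ * (ρ a * x * ρ a⁻¹) * ρ a := by rw [← hab]
    _ = (ρ a⁻¹ * ρ a) * x * (ρ a⁻¹ * ρ a) := by simp only [mul_assoc]
    _ = x := by rw [h2, one_mul, mul_one]

/-- The subgroup of elements whose action commutes with a given endomorphism. -/
def commutant (ρ : Representation F G V) (x : Module.End F V) : Subgroup G where
  carrier := {g | Commute (ρ g) x}
  one_mem' := by simp
  mul_mem' {a b} ha hb := by
    simp only [Set.mem_ofPred_eq, map_mul] at *
    exact ha.mul_left hb
  inv_mem' {a} ha := by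
    simp only [Set.mem_ofPred_eq] at *
    have h1 : ρ a * ρ a⁻¹ = 1 := by rw [← map_mul]; simp
    have h2 : ρ a⁻¹ * ρ a = 1 := by rw [← map_mul]; simp
    calc ρ a⁻¹ * x = ρ a⁻¹ * (x * ρ a) * ρ a⁻¹ := by rw [mul_assoc, mul_assoc, h1, mul_one]
      _ = x * ρ a⁻¹ := by rw [← ha.eq, ← mul_assoc, h2, one_mul]

theorem mem_commutant {ρ : Representation F G V} {x : Module.End F V} {g : G} :
    g ∈ ρ.commutant x ↔ Commute (ρ g) x := Iff.rfl

theorem finiteIndex_commutant {ρ : Representation F G V} {x : Module.End F V}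
    (h : (Set.range fun g => ρ g * x * ρ g⁻¹).Finite) : (ρ.commutant x).FiniteIndex := by
  refine Subgroup.finiteIndex_of_finite_range _ _ h fun a b hab => ?_
  exact commute_of_conj_eq hab

variable [IsAlgClosed F] [FiniteDimensional F V] [Nontrivial V]

theorem IsStronglyIrreducible.exists_eq_smul_one_of_commutant {ρ : Representation F G V}
    (hρ : ρ.IsStronglyIrreducible) (x : Module.End F V) [(ρ.commutant x).FiniteIndex] :
    ∃ c : F, x = c • 1 := by
  obtain ⟨c, hc⟩ := Module.End.exists_eigenvalue x
  refine ⟨c, ?_⟩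
  have := (hρ (ρ.commutant x) (x.eigenspace c) fun h hh w hw => ?_).resolve_left hc
  · ext v
    have hv : v ∈ x.eigenspace c := this ▸ Submodule.mem_top
    simpa using Module.End.mem_eigenspace_iff.1 hv
  · rw [Module.End.mem_eigenspace_iff] at hw ⊢
    have := LinearMap.congr_fun (mem_commutant.1 hh) w
    simp only [Module.End.mul_apply] at this
    rw [← this, hw, map_smul]

theorem IsStronglyIrreducible.exists_eq_smul_one_of_comm {ρ : Representation F G V}
    (hρ : ρ.IsStronglyIrreducible) (N : Subgroup G) [N.Normal]
    (hN : ∀ x ∈ N, ∀ y ∈ N, Commute (ρ x) (ρ y)) : ∀ x ∈ N, ∃ c : F, ρ x = c • 1 := by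
  let J : (N → F) → Submodule F V := fun χ => ⨅ n : N, Module.End.eigenspace (ρ (n : G)) (χ n)
  have hJ : ∀ χ v, v ∈ J χ ↔ ∀ n : N, ρ (n : G) v = χ n • v := fun χ v => by
    simp [J]
  have hind : iSupIndep J := by
    refine (Module.End.independent_iInf_maxGenEigenspace_of_forall_mapsTo
      (fun n : N => ρ (n : G)) fun i j φ =>
        Module.End.mapsTo_maxGenEigenspace_of_comm (hN j j.2 i i.2) φ).mono fun χ => ?_
    exact iInf_mono fun n => (Module.End.genEigenspace (ρ (n : G)) (χ n)).mono le_top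
  have hfin : {χ | J χ ≠ ⊥}.Finite := WellFoundedGT.finite_ne_bot_of_iSupIndep hind
  obtain ⟨χ, v, hv, hχ⟩ := Module.End.exists_forall_apply_eq_smul_of_commute
    (fun n : N => ρ (n : G)) (fun i j => hN i i.2 j j.2)
  let φ : G → N → F := fun g n => χ (MulAut.conjNormal g⁻¹ n)
  have key : ∀ g w, w ∈ J χ → ρ g w ∈ J (φ g) := fun g w hw => by
    rw [hJ] at hw ⊢
    intro n
    have := hw (MulAut.conjNormal g⁻¹ n)
    rw [← map_smul, ← this, ← Module.End.mul_apply, ← Module.End.mul_apply, ← map_mul, ← map_mul]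
    simp [mul_assoc]
  let H : Subgroup G :=
    { carrier := {g | φ g = χ}
      one_mem' := by ext n; simp only [φ, inv_one, map_one, MulAut.one_apply]
      mul_mem' := fun {a b} ha hb => by
        ext n
        have h1 := congrFun hb (MulAut.conjNormal a⁻¹ n)
        have h2 := congrFun ha n
        simp only [φ] at h1 h2 ⊢
        rw [mul_inv_rev, map_mul, MulAut.mul_apply, h1, h2]
      inv_mem' := fun {a} ha => by
        ext n
        have h1 := congrFun ha (MulAut.conjNormal a n)
        simp only [φ] at h1 ⊢
        rw [← MulAut.mul_apply, ← map_mul] at h1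
        simpa using h1.symm }
  have hHfin : H.FiniteIndex := by
    refine Subgroup.finiteIndex_of_finite_range H φ (hfin.subset ?_) fun a b hab => ?_
    · rintro _ ⟨g, rfl⟩ hbot
      have h0 : ρ g v = 0 := by simpa [hbot] using key g v ((hJ _ _).2 hχ)
      refine hv ?_
      have := congrArg (ρ g⁻¹) h0
      rw [← Module.End.mul_apply, ← map_mul] at this
      simpa using this
    · show φ (a⁻¹ * b) = χ
      ext n
      have h1 := congrFun hab (MulAut.conjNormal a n)
      simp only [φ] at h1 ⊢
      rw [← MulAut.mul_apply, ← map_mul] at h1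
      rw [mul_inv_rev, map_mul, MulAut.mul_apply, inv_inv, ← h1]
      simp
  have htop : J χ = ⊤ := by
    refine (hρ H (J χ) fun h hh w hw => ?_).resolve_left fun hbot => hv ?_
    · have hh' : φ h = χ := hh
      have := key h w hw
      rwa [hh'] at this
    · simpa [hbot] using (hJ _ _).2 hχ
  intro x hx
  refine ⟨χ ⟨x, hx⟩, LinearMap.ext fun w => ?_⟩
  simpa using (hJ χ w).1 (htop ▸ Submodule.mem_top) ⟨x, hx⟩

theorem IsStronglyIrreducible.exists_eq_smul_one_of_commutator {ρ : Representation F G V}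
    (hρ : ρ.IsStronglyIrreducible) (N : Subgroup G) [hNn : N.Normal]
    (hN : ∀ x ∈ N, ∀ y ∈ N, ∃ c : F, ρ x * ρ y * ρ x⁻¹ = c • ρ y) :
    ∀ x ∈ N, ∃ c : F, ρ x = c • 1 := by
  set d := Module.finrank F V with hd
  have hroots : {c : F | c ^ d = 1}.Finite := by
    refine (Polynomial.finite_setOfPred_isRoot
      (Polynomial.X_pow_sub_C_ne_zero (Module.finrank_pos (R := F) (M := V)) (1 : F))).subset
      fun c hc => ?_
    have hc : c ^ d = 1 := hc
    simp [← hd, hc]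
  have hdet : ∀ g, LinearMap.det (ρ g) ≠ 0 := fun g h => by
    have : LinearMap.det (ρ g * ρ g⁻¹) = 1 := by rw [← map_mul]; simp
    rw [map_mul, h, zero_mul] at this
    exact zero_ne_one this
  have hroot : ∀ x y (c : F), LinearMap.det (ρ x) = LinearMap.det (ρ y) → ρ x = c • ρ y →
      c ^ d = 1 := fun x y c h1 h2 => by
    rw [h2, LinearMap.det_smul] at h1
    exact mul_right_cancel₀ (hdet y) (by rw [h1, one_mul])
  have hdc : ∀ x y, LinearMap.det (ρ (x * y * x⁻¹)) = LinearMap.det (ρ y) := fun x y => by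
    rw [map_mul ρ, map_mul ρ, map_mul LinearMap.det, map_mul LinearMap.det, mul_right_comm,
      ← map_mul LinearMap.det, ← map_mul ρ]
    simp
  -- The elements of `N` acting centrally on `V` form a normal subgroup, so they act by scalars.
  let Z : Subgroup G := N ⊓ ⨅ y : N, ρ.commutant (ρ (y : G))
  have hZ : ∀ z, z ∈ Z ↔ z ∈ N ∧ ∀ y ∈ N, Commute (ρ z) (ρ y) := fun z => by
    simp [Z, Subgroup.mem_iInf, mem_commutant]
  have hZn : Z.Normal := ⟨fun z hz g => by
    rw [hZ] at hz ⊢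
    refine ⟨hNn.conj_mem z hz.1 g, fun y hy => ?_⟩
    have h := hz.2 (g⁻¹ * y * g) (by simpa using hNn.conj_mem y hy g⁻¹)
    have h' := congrArg (fun t => ρ g * t * ρ g⁻¹) h.eq
    simp only [← map_mul] at h'
    rw [Commute, SemiconjBy, ← map_mul, ← map_mul]
    convert h' using 2 <;> group⟩
  have hZs := hρ.exists_eq_smul_one_of_comm Z fun x hx y hy =>
    ((hZ x).1 hx).2 y ((hZ y).1 hy).1
  obtain ⟨s, hs, hspan⟩ := (Submodule.fg_span_iff_fg_span_finset_subset
    (R := F) ((fun n => ρ n) '' (N : Set G))).1 (IsNoetherian.noetherian _)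
  have hZ' : ∀ z ∈ N, (∀ y ∈ s, Commute (ρ z) y) → z ∈ Z := fun z hz h => by
    refine (hZ z).2 ⟨hz, fun y hy => ?_⟩
    have hy' : ρ y ∈ Submodule.span F (s : Set (Module.End F V)) := by
      rw [← hspan]; exact Submodule.subset_span ⟨y, hy, rfl⟩
    generalize ρ y = f at hy'
    induction hy' using Submodule.span_induction with
    | mem x hx => exact h x hx
    | zero => exact Commute.zero_right _
    | add x y _ _ hx hy => exact hx.add_right hy
    | smul a x _ hx => exact hx.smul_right a
  -- Finitely many endomorphisms arise from elements of `N` with a given determinant.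
  let φ : N → s → Module.End F V := fun n y => ρ (n : G) * y * ρ (n : G)⁻¹
  have hφ : (Set.range φ).Finite := by
    refine (Set.Finite.pi' (t := fun y : s =>
      (fun c : F => c • (y : Module.End F V)) '' {c : F | c ^ d = 1})
      fun y => hroots.image _).subset ?_
    rintro _ ⟨n, rfl⟩ y
    obtain ⟨m, hm, hy⟩ := hs y.2
    obtain ⟨c, hc⟩ := hN n n.2 m hm
    have hy : ρ m = y := hy
    refine ⟨c, hroot (n * m * (n : G)⁻¹) m c (hdc _ _) (by simpa [mul_assoc] using hc), ?_⟩
    simp only [φ, ← hy, hc]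
  intro x hx
  have hfin : {f | ∃ n ∈ N, ρ n = f ∧ LinearMap.det f = LinearMap.det (ρ x)}.Finite := by
    let T : Set N := {n | LinearMap.det (ρ (n : G)) = LinearMap.det (ρ x)}
    have : Nonempty T := ⟨⟨⟨x, hx⟩, rfl⟩⟩
    let ψ : T → s → Module.End F V := fun n => φ n
    have hψ : (Set.range ψ).Finite := hφ.subset (by rintro _ ⟨n, rfl⟩; exact ⟨n, rfl⟩)
    refine (Set.Finite.image2 (fun p c => c • ρ ((Function.invFun ψ p : T) : N)) hψ
      hroots).subset ?_
    rintro _ ⟨n, hn, rfl, hdn⟩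
    let t : T := ⟨⟨n, hn⟩, hdn⟩
    set t' : T := Function.invFun ψ (ψ t) with ht'
    have htt' : ψ t' = ψ t := Function.invFun_eq ⟨t, rfl⟩
    have hz : ((t' : N) : G)⁻¹ * n ∈ Z := by
      refine hZ' _ (N.mul_mem (N.inv_mem (t' : N).2) hn) fun y hy => ?_
      have h1 := congrFun htt' ⟨y, hy⟩
      simp only [ψ, φ] at h1
      exact commute_of_conj_eq h1
    obtain ⟨c, hc⟩ := hZs _ hz
    have hc' : ρ n = c • ρ (t' : N) := by
      have := congrArg (fun u => ρ (t' : N) * u) hc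
      simp only [← map_mul] at this
      simpa using this
    exact ⟨ψ t, ⟨t, rfl⟩, c, hroot _ _ c (hdn.trans t'.2.symm) hc', hc'.symm⟩
  have : (ρ.commutant (ρ x)).FiniteIndex := by
    refine finiteIndex_commutant (hfin.subset ?_)
    rintro _ ⟨g, rfl⟩
    refine ⟨g * x * g⁻¹, hNn.conj_mem x hx g, by simp [mul_assoc], ?_⟩
    simpa [mul_assoc] using hdc g x
  exact hρ.exists_eq_smul_one_of_commutant (ρ x)

theorem IsStronglyIrreducible.exists_eq_smul_one_of_isSolvable [Group.IsSolvable G]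
    {ρ : Representation F G V} (hρ : ρ.IsStronglyIrreducible) (g : G) : ∃ c : F, ρ g = c • 1 := by
  obtain ⟨n, hn⟩ := Group.IsSolvable.solvable (G := G)
  have key : ∀ k ≤ n, ∀ x ∈ derivedSeries G k, ∃ c : F, ρ x = c • 1 := fun k hk => by
    induction hk using Nat.decreasingInduction with
    | self =>
      rw [hn]
      intro x hx
      rw [Subgroup.mem_bot.1 hx]
      exact ⟨1, by simp⟩
    | of_succ k hk ih =>
      refine hρ.exists_eq_smul_one_of_commutator _ fun x hx y hy => ?_
      obtain ⟨c, hc⟩ := ih (x * y * x⁻¹ * y⁻¹) (Subgroup.commutator_mem_commutator hx hy)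
      refine ⟨c, ?_⟩
      have h : x * y * x⁻¹ = x * y * x⁻¹ * y⁻¹ * y := by simp
      rw [← map_mul, ← map_mul, h, map_mul, hc, smul_one_mul]
  exact key 0 (Nat.zero_le _) g (Subgroup.mem_top g)

theorem exists_finiteIndex_forall_apply_eq_smul [Group.IsSolvable G] (ρ : Representation F G V) :
    ∃ (H : Subgroup G) (v : V), H.FiniteIndex ∧ v ≠ 0 ∧ ∀ h ∈ H, ∃ c : F, ρ h v = c • v := by
  induction h : Module.finrank F V using Nat.strong_induction_on generalizing V G with
  | _ n ih =>
  by_cases hρ : ρ.IsStronglyIrreducible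
  · obtain ⟨v, hv⟩ := exists_ne (0 : V)
    refine ⟨⊤, v, inferInstance, hv, fun g _ => ?_⟩
    obtain ⟨c, hc⟩ := hρ.exists_eq_smul_one_of_isSolvable g
    exact ⟨c, by simp [hc]⟩
  · simp only [IsStronglyIrreducible, not_forall, not_or] at hρ
    obtain ⟨H, hH, W, hW, hbot, htop⟩ := hρ
    have : Nontrivial W := Submodule.nontrivial_iff_ne_bot.2 hbot
    let σ : Representation F H W :=
      { toFun := fun g => (ρ (g : G)).restrict (hW g g.2)
        map_one' := by ext; simp
        map_mul' := fun a b => by ext; simp }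
    obtain ⟨K, w, hK, hw, hKw⟩ := ih _ (h ▸ Submodule.finrank_lt htop) σ rfl
    refine ⟨K.map H.subtype, w, ⟨?_⟩, by simpa using hw, ?_⟩
    · rw [Subgroup.index_map_subtype]
      exact mul_ne_zero hK.index_ne_zero hH.index_ne_zero
    · rintro _ ⟨k, hk, rfl⟩
      obtain ⟨c, hc⟩ := hKw k hk
      exact ⟨c, by simpa [σ] using congrArg Subtype.val hc⟩

end Representation

open NumberField in
theorem Subgroup.fg_of_forall_isIntegral {F : Type*} [Field F] [CharZero F] (K : Subfield F)
    [NumberField K] (C : Subgroup Fˣ) (hK : ∀ c ∈ C, (c : F) ∈ K)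
    (hC : ∀ c ∈ C, IsIntegral ℤ (c : F)) : Group.FG C := by
  let ι : (𝓞 K)ˣ →* Fˣ := Units.map ((algebraMap K F).comp (algebraMap (𝓞 K) K) : 𝓞 K →* F)
  have : Group.FG (𝓞 K)ˣ := Group.fg_iff_monoid_fg.2 inferInstance
  have hle : C ≤ ι.range := fun c hc => by
    have hint : ∀ x (hx : x ∈ C), IsIntegral ℤ (⟨x, hK x hx⟩ : K) := fun x hx =>
      (isIntegral_algebraMap_iff (algebraMap K F).injective).1 (hC x hx)
    refine ⟨⟨⟨_, hint c hc⟩, ⟨_, hint c⁻¹ (C.inv_mem hc)⟩, ?_, ?_⟩, ?_⟩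
    · exact RingOfIntegers.ext (Subtype.ext c.mul_inv)
    · exact RingOfIntegers.ext (Subtype.ext c.inv_mul)
    · ext; rfl
  exact Group.fg_of_injective_of_comm (Subgroup.inclusion hle) (Subgroup.inclusion_injective hle)

/-- **Malcev theorem**: solvable groups of automorphisms of a finitely generated free abelian
group are finitely generated. -/
theorem Subgroup.fg_of_isSolvable_generalLinearGroup_int {M : Type*} [AddCommGroup M]
    [Module.Finite ℤ M] [Module.IsTorsionFree ℤ M] (G : Subgroup (Module.End ℤ M)ˣ)
    [hG : Group.IsSolvable G] : Group.FG G := by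
  induction h : Module.finrank ℤ M using Nat.strong_induction_on generalizing M with
  | _ n ih =>
  rcases subsingleton_or_nontrivial M with hM | hM
  · have : Subsingleton G := ⟨fun a b => Subtype.ext (Units.ext (Subsingleton.elim _ _))⟩
    infer_instance
  let F := AlgebraicClosure ℚ
  have : Module.Free ℤ M := inferInstance
  have : Nontrivial (M →ₗ[ℤ] F) := by
    let b := Module.Free.chooseBasis ℤ M
    obtain ⟨i⟩ := b.index_nonempty
    refine ⟨⟨(Algebra.linearMap ℤ F) ∘ₗ b.coord i, 0, fun h0 => ?_⟩⟩
    simpa using LinearMap.congr_fun h0 (b i)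
  let ρ : Representation F G (M →ₗ[ℤ] F) :=
    { toFun := fun g =>
        { toFun := fun φ => φ ∘ₗ (g⁻¹).1.1
          map_add' := fun _ _ => rfl
          map_smul' := fun _ _ => rfl }
      map_one' := by ext; simp
      map_mul' := fun a b => by ext; simp }
  obtain ⟨H, φ, hH, hφ, hHφ⟩ := ρ.exists_finiteIndex_forall_apply_eq_smul
  choose c hc using fun h : H => hHφ h h.2
  have hcM : ∀ (h : H) (m : M), φ (((h : G)⁻¹ : G).1.1 m) = c h * φ m := fun h m => by
    simpa [ρ] using LinearMap.congr_fun (hc h) m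
  let χ : H →* F :=
    { toFun := c
      map_one' := smul_left_injective F hφ (by simp [← hc])
      map_mul' := fun a b => smul_left_injective F hφ (by
        change c (a * b) • φ = (c a * c b) • φ
        rw [mul_comm (c a), mul_smul, ← hc, ← hc, Subgroup.coe_mul, map_mul, Module.End.mul_apply,
          hc b, map_smul]) }
  let K : IntermediateField ℚ F :=
    IntermediateField.adjoin ℚ (Set.range fun i => φ (Module.Free.chooseBasis ℤ M i))
  have hKfin : FiniteDimensional ℚ K :=
    IntermediateField.finiteDimensional_adjoin fun x _ =>
      (AlgebraicClosure.isAlgebraic ℚ).isAlgebraic x |>.isIntegral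
  have : NumberField K := ⟨⟩
  have hφK : ∀ m, φ m ∈ K := fun m => by
    rw [← (Module.Free.chooseBasis ℤ M).sum_repr m, map_sum]
    refine sum_mem fun i _ => ?_
    rw [map_smul]
    exact zsmul_mem (IntermediateField.subset_adjoin ℚ _ (Set.mem_range_self i)) _
  obtain ⟨m₀, hm₀⟩ : ∃ m, φ m ≠ 0 := by
    by_contra! h0
    exact hφ (LinearMap.ext h0)
  have hχ : Group.FG χ.toHomUnits.range := by
    have : NumberField K.toSubfield := ‹NumberField K›
    refine Subgroup.fg_of_forall_isIntegral K.toSubfield _ ?_ ?_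
    · rintro _ ⟨h, rfl⟩
      show c h ∈ K
      rw [eq_div_of_mul_eq hm₀ (hcM h m₀).symm]
      exact K.div_mem (hφK _) (hφK _)
    · rintro _ ⟨h, rfl⟩
      have hfg : (LinearMap.range φ).FG := Module.Finite.iff_fg.1 inferInstance
      refine isIntegral_of_smul_mem_submodule (LinearMap.range φ) ?_ hfg _ ?_
      · exact fun h0 => hm₀ (by simpa [h0] using LinearMap.mem_range_self φ m₀)
      · rintro _ ⟨m, rfl⟩
        exact ⟨_, hcM h m⟩
  have hker : Group.FG χ.toHomUnits.ker := by
    set H₁ := χ.toHomUnits.ker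
    have hH₁ : ∀ (h : H₁) (m : M), φ (((h : H) : G).1.1 m) = φ m := fun h m => by
      have h1 : c h = 1 := congrArg Units.val h.2
      have := hcM h (((h : H) : G).1.1 m)
      rw [h1, one_mul] at this
      rw [← this]
      exact congrArg φ (LinearMap.congr_fun ((h : H) : G).1.inv_mul m)
    let L := LinearMap.ker φ
    have hL : ∀ (h : H₁), ∀ x ∈ L, ((h : H) : G).1.1 x ∈ L := fun h x hx => by
      rw [LinearMap.mem_ker] at hx ⊢
      rw [hH₁, hx]
    let r₀ : H₁ →* Module.End ℤ L :=
      { toFun := fun h => ((h : H) : G).1.1.restrict (hL h)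
        map_one' := by ext; simp
        map_mul' := fun a b => by ext; simp }
    refine Group.fg_of_fg_ker_of_fg_range r₀.toHomUnits ?_ ?_
    · let e : r₀.toHomUnits.ker →* Multiplicative (Module.End ℤ M) :=
        { toFun := fun h => Multiplicative.ofAdd ((((h : H₁) : H) : G).1.1 - 1)
          map_one' := by simp
          map_mul' := fun a b => by
            rw [← ofAdd_add]
            congr 1
            ext m
            have hm : (((b : H₁) : H) : G).1.1 m - m ∈ L := by
              rw [LinearMap.mem_ker, map_sub, hH₁, sub_self]
            have h2 : (((a : H₁) : H) : G).1.1 ((((b : H₁) : H) : G).1.1 m - m) =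
                (((b : H₁) : H) : G).1.1 m - m :=
              congrArg (fun u : (Module.End ℤ L)ˣ => ((u : Module.End ℤ L) ⟨_, hm⟩ : M)) a.2
            rw [map_sub] at h2
            rw [sub_eq_iff_eq_add] at h2
            simp only [Subgroup.coe_mul, Units.val_mul, LinearMap.sub_apply, Module.End.mul_apply,
              Module.End.one_apply, LinearMap.add_apply, h2]
            abel }
      have : Group.FG (Multiplicative (Module.End ℤ M)) := by
        have : AddGroup.FG (Module.End ℤ M) := Module.Finite.iff_addGroup_fg.1 inferInstance
        infer_instance
      refine Group.fg_of_injective_of_comm e fun a b hab => ?_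
      have := sub_left_injective (Multiplicative.ofAdd.injective hab)
      exact Subtype.ext (Subtype.ext (Subtype.ext (Subtype.ext (Units.ext this))))
    · have hlt : Module.finrank ℤ L < n := by
        have h1 := Submodule.finrank_quotient_add_finrank L
        rw [φ.quotKerEquivRange.finrank_eq] at h1
        have : Module.Finite ℤ (LinearMap.range φ) := inferInstance
        have : Nontrivial (LinearMap.range φ) :=
          ⟨⟨⟨φ m₀, m₀, rfl⟩, 0, fun h0 => hm₀ (congrArg Subtype.val h0)⟩⟩
        have h2 : 0 < Module.finrank ℤ (LinearMap.range φ) := Module.finrank_pos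
        omega
      have : Group.IsSolvable r₀.toHomUnits.range :=
        Group.isSolvable_of_surjective r₀.toHomUnits.rangeRestrict_surjective
      exact ih _ hlt r₀.toHomUnits.range rfl
  have : Group.FG H := Group.fg_of_fg_ker_of_fg_range χ.toHomUnits hker hχ
  exact Group.fg_of_finiteIndex H

namespace CoxeterMatrix

variable {B : Type*} (M : CoxeterMatrix B)

open Real Polynomial.Chebyshev

/-- The linear form `α ↦ 2⟨α i, α⟩`, for the Tits form `⟨α i, α j⟩ = -cos (π / M i j)`. -/
noncomputable def simpleCoroot (i : B) : Module.Dual ℝ (B →₀ ℝ) :=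
  Finsupp.linearCombination ℝ fun j => -(2 * cos (π / M i j))

theorem simpleCoroot_single (i j : B) (a : ℝ) :
    M.simpleCoroot i (Finsupp.single j a) = -(2 * cos (π / M i j)) * a := by
  simp [simpleCoroot, mul_comm]

theorem simpleCoroot_single_self (i : B) :
    M.simpleCoroot i (Finsupp.single i 1) = 2 := by
  simp [simpleCoroot_single]

/-- The reflection of the Tits representation attached to a simple generator. -/
noncomputable def simpleReflection (i : B) : (B →₀ ℝ) ≃ₗ[ℝ] (B →₀ ℝ) :=
  Module.reflection (M.simpleCoroot_single_self i)

theorem simpleReflection_apply (i : B) (v : B →₀ ℝ) :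
    M.simpleReflection i v = v - M.simpleCoroot i v • Finsupp.single i 1 :=
  Module.reflection_apply _ _

theorem isLiftable_simpleReflection : M.IsLiftable M.simpleReflection := fun i j => by
  rcases eq_or_ne i j with rfl | hij
  · ext1 v
    simp [simpleReflection, Module.involutive_reflection _ v]
  obtain h0 | h0 := eq_or_ne (M i j) 0
  · simp [h0]
  have h1 : M i j ≠ 1 := fun h => hij (by
    by_contra hne
    exact M.off_diagonal i j hne h)
  set m := M i j with hm
  ext1 v
  set θ := π / m with hθ
  have hmθ : m * θ = π := by rw [hθ]; field_simp
  have ht : 2 * cos (2 * θ) = M.simpleCoroot i (Finsupp.single j 1) *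
      M.simpleCoroot j (Finsupp.single i 1) - 2 := by
    rw [simpleCoroot_single, simpleCoroot_single, M.symmetric j i, ← hm, ← hθ, cos_two_mul]
    ring
  refine (Module.reflection_mul_reflection_pow_apply (M.simpleCoroot_single_self i)
    (M.simpleCoroot_single_self j) m v (2 * cos (2 * θ)) ht).trans ?_
  obtain h2 | h3 : m = 2 ∨ 3 ≤ m := by omega
  · have hθ2 : θ = π / 2 := by rw [hθ, h2]; norm_num
    have hc : cos (2 * θ) = -1 := by rw [hθ2, mul_div_cancel₀ _ two_ne_zero, cos_pi]
    simp only [simpleCoroot_single, M.symmetric j i, ← hm, ← hθ]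
    rw [h2, hc, hθ2]
    norm_num
    module
  · have hsin : sin (2 * θ) ≠ 0 := by
      have h3' : (3 : ℝ) ≤ m := by exact_mod_cast h3
      have : 0 < θ := by positivity
      refine (sin_pos_of_pos_of_lt_pi (by positivity) ?_).ne'
      nlinarith
    have hS (k : ℤ) : (S ℝ k).eval (2 * cos (2 * θ)) = sin ((k + 1) * (2 * θ)) / sin (2 * θ) := by
      rw [← S_two_mul_real_cos, mul_div_cancel_right₀ _ hsin]
    obtain ⟨k, hk | hk⟩ := m.even_or_odd'
    · have e1 : ((m : ℤ) - 2) / 2 = k - 1 := by omega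
      have e2 : ((m : ℤ) - 1) / 2 = k - 1 := by omega
      have hz : (S ℝ ((k : ℤ) - 1)).eval (2 * cos (2 * θ)) = 0 := by
        rw [hS, div_eq_zero_iff]
        left
        rw [← sin_pi, ← hmθ, hk]
        push_cast
        ring_nf
      simp [e1, e2, hz]
    · have e1 : ((m : ℤ) - 2) / 2 = k - 1 := by omega
      have e2 : ((m : ℤ) - 1) / 2 = k := by omega
      have e3 : ((m : ℤ) - 3) / 2 = k - 1 := by omega
      have e4 : (m : ℤ) / 2 = k := by omega
      have hz : (S ℝ (k : ℤ)).eval (2 * cos (2 * θ)) +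
          (S ℝ ((k : ℤ) - 1)).eval (2 * cos (2 * θ)) = 0 := by
        rw [hS, hS, ← add_div, div_eq_zero_iff]
        left
        have h1 : (((k : ℤ) : ℝ) + 1) * (2 * θ) = π + θ := by
          rw [← hmθ, hk]; push_cast; ring
        have h2 : ((((k : ℤ) - 1 : ℤ) : ℝ) + 1) * (2 * θ) = π - θ := by
          rw [← hmθ, hk]; push_cast; ring
        rw [h1, h2, sin_pi_sub, add_comm π, sin_add_pi]
        ring
      simp [e1, e2, e3, e4, hz]

theorem eval_S_nonneg {m k : ℕ} (hm : m ≠ 1) (hk : m = 0 ∨ k ≤ m) :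
    0 ≤ (S ℝ ((k : ℤ) - 1)).eval (2 * cos (π / m)) := by
  obtain rfl | h0 := eq_or_ne m 0
  · simp [S_eval_two]
  have h2 : (2 : ℝ) ≤ m := by exact_mod_cast (show 2 ≤ m by omega)
  have hkm : (k : ℝ) ≤ m := by exact_mod_cast hk.resolve_left h0
  have hθ : 0 < π / m := by positivity
  have hmθ : m * (π / m) = π := by field_simp
  have hsin : 0 < sin (π / m) := sin_pos_of_pos_of_lt_pi hθ (by nlinarith)
  have hS := S_two_mul_real_cos (π / m) ((k : ℤ) - 1)
  refine nonneg_of_mul_nonneg_left (hS ▸ ?_) hsin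
  push_cast
  rw [sub_add_cancel]
  exact sin_nonneg_of_nonneg_of_le_pi (by positivity) (by nlinarith)

end CoxeterMatrix

namespace CoxeterSystem

variable {B W : Type*} [Group W] {M : CoxeterMatrix B} (cs : CoxeterSystem M W)

open Real Polynomial.Chebyshev

/-- The Tits representation of a Coxeter group. -/
noncomputable def titsRep : W →* ((B →₀ ℝ) ≃ₗ[ℝ] (B →₀ ℝ)) :=
  cs.lift ⟨M.simpleReflection, M.isLiftable_simpleReflection⟩

theorem titsRep_simple (i : B) : cs.titsRep (cs.simple i) = M.simpleReflection i :=
  cs.lift_apply_simple M.isLiftable_simpleReflection i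

theorem titsRep_simple_single (i j : B) :
    cs.titsRep (cs.simple i) (Finsupp.single j 1) =
      Finsupp.single j 1 + (2 * cos (π / M i j)) • Finsupp.single i 1 := by
  rw [titsRep_simple, M.simpleReflection_apply, M.simpleCoroot_single]
  module

theorem titsRep_simple_single_self (i : B) :
    cs.titsRep (cs.simple i) (Finsupp.single i 1) = -Finsupp.single i 1 := by
  rw [titsRep_simple]
  exact Module.reflection_apply_self _

theorem titsRep_wordProd_alternatingWord (i j : B) (k : ℕ) :
    cs.titsRep (cs.wordProd (alternatingWord i j k)) (Finsupp.single i 1) =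
      (S ℝ k).eval (2 * cos (π / M i j)) • Finsupp.single (if Even k then i else j) (1 : ℝ) +
        (S ℝ ((k : ℤ) - 1)).eval (2 * cos (π / M i j)) •
          Finsupp.single (if Even k then j else i) (1 : ℝ) := by
  induction k with
  | zero => simp [alternatingWord]
  | succ k ih =>
    have hS : (S ℝ ((k : ℤ) + 1)).eval (2 * cos (π / M i j)) =
        2 * cos (π / M i j) * (S ℝ k).eval (2 * cos (π / M i j)) -
          (S ℝ ((k : ℤ) - 1)).eval (2 * cos (π / M i j)) := by
      simp [S_add_one]
    rw [alternatingWord_succ', wordProd_cons, map_mul, LinearEquiv.mul_apply, ih, map_add, map_smul,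
      map_smul]
    push_cast
    rw [hS, add_sub_cancel_right]
    by_cases h : Even k
    · have h' : ¬ Even (k + 1) := by simpa [Nat.even_add_one] using h
      simp only [h, h', if_true, if_false, titsRep_simple_single, M.symmetric j i,
        M.diagonal, Nat.cast_one, div_one, cos_pi]
      module
    · have h' : Even (k + 1) := by simpa [Nat.even_add_one] using h
      simp only [h, h', if_true, if_false, titsRep_simple_single, M.diagonal, Nat.cast_one,
        div_one, cos_pi]
      module

/-- If `ℓ(w s) > ℓ(w)`, then `w` sends the simple root of `s` to a positive root. -/
theorem titsRep_single_nonneg (w : W) (s : B) (hs : ¬ cs.IsRightDescent w s) :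
    0 ≤ cs.titsRep w (Finsupp.single s 1) := by
  induction h : cs.length w using Nat.strong_induction_on generalizing w s with
  | _ n ih =>
  obtain rfl | hw := eq_or_ne w 1
  · simp
  obtain ⟨t, ht⟩ := cs.exists_rightDescent_of_ne_one hw
  have hst : s ≠ t := fun e => hs (e ▸ ht)
  let P (k : ℕ) : Prop :=
    ∃ v, w = v * cs.wordProd (alternatingWord s t k) ∧ cs.length v + k = cs.length w
  have hP1 : P 1 := ⟨w * cs.simple t, by simp [alternatingWord], cs.isRightDescent_iff.1 ht⟩
  have hPle (k : ℕ) (hk : P k) : k ≤ cs.length w := by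
    obtain ⟨v, -, hv⟩ := hk
    omega
  classical
  set k := Nat.findGreatest P (cs.length w) with hk
  have hk1 : 1 ≤ k := Nat.le_findGreatest (hPle 1 hP1) hP1
  have hPk : P k := Nat.findGreatest_spec (hPle 1 hP1) hP1
  have hPk' : ¬ P (k + 1) := fun hP => by
    have := Nat.le_findGreatest (hPle _ hP) hP
    omega
  obtain ⟨v, hwv, hlen⟩ := hPk
  have hnext : ¬ cs.IsRightDescent v (if Even k then t else s) := fun hd => by
    refine hPk' ⟨v * cs.simple (if Even k then t else s), ?_, ?_⟩
    · rw [alternatingWord_succ', wordProd_cons, mul_assoc, simple_mul_simple_cancel_left, ← hwv]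
    · have := cs.isRightDescent_iff.1 hd
      omega
  have hprev : ¬ cs.IsRightDescent v (if Even k then s else t) := fun hd => by
    obtain ⟨k', hk'⟩ := Nat.exists_eq_succ_of_ne_zero (by omega : k ≠ 0)
    have e : (if Even k then s else t) = if Even k' then t else s := by
      rw [hk', Nat.succ_eq_add_one]
      by_cases h : Even k' <;> simp [Nat.even_add_one, h]
    rw [hk', Nat.succ_eq_add_one, alternatingWord_succ', wordProd_cons, ← e, ← mul_assoc] at hwv
    have h1 := cs.length_mul_le (v * cs.simple (if Even k then s else t))
      (cs.wordProd (alternatingWord s t k'))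
    have h2 := cs.length_wordProd_le (alternatingWord s t k')
    rw [length_alternatingWord] at h2
    rw [← hwv] at h1
    have := cs.isRightDescent_iff.1 hd
    omega
  have hvs : ¬ cs.IsRightDescent v s := by
    by_cases h : Even k
    · simpa [h] using hprev
    · simpa [h] using hnext
  have hvt : ¬ cs.IsRightDescent v t := by
    by_cases h : Even k
    · simpa [h] using hnext
    · simpa [h] using hprev
  have hkm : M s t = 0 ∨ k + 1 ≤ M s t := by
    by_contra! hcon
    have hred := cs.not_isReduced_alternatingWord t s (m := k + 1)
      (by rw [M.symmetric]; exact hcon.1) (by rw [M.symmetric]; exact hcon.2)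
    have h1 := cs.length_wordProd_le (alternatingWord t s (k + 1))
    rw [IsReduced] at hred
    rw [length_alternatingWord] at h1 hred
    have h2 := cs.not_isRightDescent_iff.1 hs
    have h3 : w * cs.simple s = v * cs.wordProd (alternatingWord t s (k + 1)) := by
      rw [alternatingWord_succ, wordProd_concat, ← mul_assoc, ← hwv]
    have h4 := cs.length_mul_le v (cs.wordProd (alternatingWord t s (k + 1)))
    rw [← h3] at h4
    omega
  have hIs := ih _ (by omega) v s hvs rfl
  have hIt := ih _ (by omega) v t hvt rfl
  have hm1 := M.off_diagonal s t hst
  have hu1 := CoxeterMatrix.eval_S_nonneg (k := k + 1) hm1 hkm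
  have hu2 := CoxeterMatrix.eval_S_nonneg (k := k) hm1 (by omega)
  push_cast at hu1
  rw [add_sub_cancel_right] at hu1
  rw [hwv, map_mul, LinearEquiv.mul_apply, titsRep_wordProd_alternatingWord, map_add, map_smul,
    map_smul]
  refine add_nonneg (smul_nonneg hu1 ?_) (smul_nonneg hu2 ?_) <;> split_ifs <;> assumption

theorem titsRep_injective : Function.Injective cs.titsRep := by
  refine (injective_iff_map_eq_one _).2 fun w hw => ?_
  by_contra hne
  obtain ⟨s, hs⟩ := cs.exists_rightDescent_of_ne_one hne
  have h := cs.titsRep_single_nonneg _ s (cs.isRightDescent_iff_not_isRightDescent_mul.1 hs) s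
  rw [map_mul, hw, one_mul, titsRep_simple_single_self] at h
  norm_num at h

end CoxeterSystem

/-- The Tits representation of a Coxeter group of finite rank preserves a finitely generated
subgroup which contains the simple roots. -/
theorem CoxeterSystem.exists_invariant_lattice {B W : Type*} [Group W] [Finite B]
    {M : CoxeterMatrix B} (cs : CoxeterSystem M W) :
    ∃ L : Submodule ℤ (B →₀ ℝ), Module.Finite ℤ L ∧ (∀ i, Finsupp.single i 1 ∈ L) ∧
      ∀ w, ∀ v ∈ L, cs.titsRep w v ∈ L := by
  let T : Set ℝ := Set.range fun p : B × B => 2 * Real.cos (Real.pi / M p.1 p.2)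
  let R : Subalgebra ℤ ℝ := Algebra.adjoin ℤ T
  have hR : Module.Finite ℤ R := by
    refine Module.Finite.iff_fg.2 (fg_adjoin_of_finite (Set.finite_range _) ?_)
    rintro _ ⟨⟨i, j⟩, rfl⟩
    have := Real.isIntegral_two_mul_cos_rat_mul_pi (1 / M i j)
    push_cast at this
    rwa [one_div_mul_eq_div] at this
  let L : Submodule R (B →₀ ℝ) := Submodule.span R (Set.range fun i => Finsupp.single i 1)
  have hL : Module.Finite R L := Module.Finite.span_of_finite R (Set.finite_range _)
  have hroot (i : B) : Finsupp.single i 1 ∈ L := Submodule.subset_span (Set.mem_range_self i)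
  have hsimple (i : B) (v : B →₀ ℝ) (hv : v ∈ L) : cs.titsRep (cs.simple i) v ∈ L := by
    induction hv using Submodule.span_induction with
    | mem x hx =>
      obtain ⟨j, rfl⟩ := hx
      rw [cs.titsRep_simple_single]
      exact L.add_mem (hroot j)
        (L.smul_mem (⟨_, Algebra.subset_adjoin ⟨(i, j), rfl⟩⟩ : R) (hroot i))
    | zero => simp
    | add x y _ _ hx hy => rw [map_add]; exact L.add_mem hx hy
    | smul a x _ hx =>
      rw [show a • x = (a : ℝ) • x from rfl, map_smul]
      exact L.smul_mem a hx
  refine ⟨L.restrictScalars ℤ, Module.Finite.trans (R := ℤ) R L, hroot, fun w => ?_⟩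
  refine cs.simple_induction (p := fun w => ∀ v ∈ L, cs.titsRep w v ∈ L) w hsimple (by simp)
    fun w w' hw hw' v hv => ?_
  rw [map_mul, LinearEquiv.mul_apply]
  exact hw _ (hw' v hv)

/-- Let (W, S) be a Coxeter system whose set of simple reflections is finite (i.e. the
index set `B` of the Coxeter matrix is finite). Then every solvable subgroup of `W`
is finitely generated. -/
theorem solvable_subgroup_of_coxeter_fg {B W : Type*} [Group W] [Finite B]
    (M : CoxeterMatrix B) (cs : CoxeterSystem M W)
    (A : Subgroup W) (hA : IsSolvable A) : A.FG := by
  obtain ⟨L, hfin, hroot, hstable⟩ := cs.exists_invariant_lattice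
  let r : A →* Module.End ℤ L :=
    { toFun := fun a => ((cs.titsRep a).toLinearMap.restrictScalars ℤ).restrict (hstable a)
      map_one' := by ext; simp
      map_mul' := fun a b => by
        ext v : 2
        exact LinearMap.congr_fun
          (congrArg LinearEquiv.toLinearMap (map_mul cs.titsRep (a : W) b)) v }
  have hinj : Function.Injective r.toHomUnits := fun a b hab => by
    refine Subtype.ext (cs.titsRep_injective ?_)
    refine LinearEquiv.toLinearMap_injective (Finsupp.lhom_ext' fun i => LinearMap.ext_ring ?_)
    exact congrArg (fun u : (Module.End ℤ L)ˣ => ((u : Module.End ℤ L) ⟨_, hroot i⟩ : B →₀ ℝ)) hab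
  have : Group.IsSolvable A := hA
  have : Group.IsSolvable r.toHomUnits.range :=
    Group.isSolvable_of_surjective r.toHomUnits.rangeRestrict_surjective
  have := Subgroup.fg_of_isSolvable_generalLinearGroup_int r.toHomUnits.range
  exact (Group.fg_iff_subgroup_fg A).1
    (Group.fg_of_surjective (f := (MonoidHom.ofInjective hinj).symm.toMonoidHom)
      (MonoidHom.ofInjective hinj).symm.surjective)
end

section
/- The group SL₂(ℚ) of 2×2 rational matrices of determinant 1 has no proper subgroup of finite index: every subgroup H ≤ SL₂(ℚ) of finite index equals SL₂(ℚ). -/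
namespace Matrix.SpecialLinearGroup

variable {ι : Type*} [DecidableEq ι] [Fintype ι] {i j : ι}

lemma transvection_nsmul {R : Type*} [CommRing R] (hij : i ≠ j) (n : ℕ) (b : R) :
    transvection hij (n • b) = transvection hij b ^ n := by
  induction n with
  | zero => simp
  | succ n ih => rw [succ_nsmul, transvection_add, ih, pow_succ]

/-- Transvections over a field of characteristic zero form divisible subgroups, so they lie in
every finite-index subgroup. -/
lemma transvection_mem_of_finiteIndex {F : Type*} [Field F] [CharZero F]
    (H : Subgroup (SpecialLinearGroup ι F)) [H.FiniteIndex] (hij : i ≠ j) (b : F) :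
    transvection hij b ∈ H := by
  have hn : (H.normalCore.index : F) ≠ 0 :=
    Nat.cast_ne_zero.mpr Subgroup.FiniteIndex.index_ne_zero
  have h := H.normalCore.pow_index_mem (transvection hij (b / H.normalCore.index))
  rw [← transvection_nsmul, nsmul_eq_mul, mul_div_cancel₀ b hn] at h
  exact H.normalCore_le h

/-- A matrix in `SL₂(F)` with nonzero lower-left entry is a product of three transvections. -/
lemma eq_transvection_mul_mul {F : Type*} [Field F] (A : SpecialLinearGroup (Fin 2) F)
    (hc : A 1 0 ≠ 0) :
    A = transvection zero_ne_one ((A 0 0 - 1) / A 1 0) * transvection one_ne_zero (A 1 0) *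
      transvection zero_ne_one ((A 1 1 - 1) / A 1 0) := by
  have hdet := A.det_coe
  rw [Matrix.det_fin_two] at hdet
  ext i j
  fin_cases i <;> fin_cases j <;>
    simp [transvection_coe, Matrix.mul_apply, Fin.sum_univ_two, Matrix.single_apply] <;>
    field_simp <;> first | linear_combination -hdet | ring

/-- Transvections generate `SL₂` of a field. -/
lemma eq_top_of_transvection_mem {F : Type*} [Field F]
    (H : Subgroup (SpecialLinearGroup (Fin 2) F))
    (hH : ∀ (i j : Fin 2) (hij : i ≠ j) (b : F), transvection hij b ∈ H) : H = ⊤ := by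
  have key (A : SpecialLinearGroup (Fin 2) F) (hc : A 1 0 ≠ 0) : A ∈ H := by
    rw [eq_transvection_mul_mul A hc]
    exact H.mul_mem (H.mul_mem (hH _ _ _ _) (hH _ _ _ _)) (hH _ _ _ _)
  refine (Subgroup.eq_top_iff' H).mpr fun A ↦ ?_
  by_cases hc : A 1 0 = 0
  · refine (H.mul_mem_cancel_left (hH 1 0 one_ne_zero 1)).mp (key _ ?_)
    have hdet := A.det_coe
    rw [Matrix.det_fin_two, hc, mul_zero, sub_zero] at hdet
    have ha : A 0 0 ≠ 0 := left_ne_zero_of_mul_eq_one hdet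
    simpa [transvection_coe, Matrix.mul_apply, Fin.sum_univ_two, Matrix.single_apply, hc] using ha
  · exact key A hc

end Matrix.SpecialLinearGroup

/-- `SL₂(ℚ)` has no proper finite-index subgroup: every finite-index subgroup is the
whole group. -/
theorem sl2_rat_no_proper_finite_index_subgroup
    (H : Subgroup (Matrix.SpecialLinearGroup (Fin 2) ℚ)) (hH : H.FiniteIndex) :
    H = ⊤ :=
  Matrix.SpecialLinearGroup.eq_top_of_transvection_mem H fun _ _ hij b ↦
    Matrix.SpecialLinearGroup.transvection_mem_of_finiteIndex H hij b
end

section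
/- Let k be an infinite field, let n be a natural number, and let S be a subgroup of the group (kˣ)ⁿ (the n-fold direct product of the multiplicative group of k) such that the quotient group (kˣ)ⁿ / S is finitely generated. Then S is Zariski dense in (kˣ)ⁿ: every polynomial f ∈ k[X₁, …, Xₙ] that vanishes at every point of S (viewed as a subset of kⁿ) vanishes at every point of (kˣ)ⁿ ⊆ kⁿ. -/
/-- The ring of integers is a Jacobson ring. -/
theorem Int.isJacobsonRing : IsJacobsonRing ℤ := by
  rw [isJacobsonRing_iff_prime_eq]
  intro P hP
  rcases eq_or_ne P ⊥ with rfl | hne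
  · refine (Submodule.eq_bot_iff _).2 fun x hx => ?_
    have h := Int.isUnit_iff.1 (Ideal.mem_jacobson_bot.1 hx 3)
    omega
  · have := hP.isMaximal hne
    exact Ideal.jacobson_eq_self_of_isMaximal

/-- A field that is finitely generated as a ring is finite. -/
theorem Field.finite_of_finiteType_int (K : Type*) [Field K] [Algebra.FiniteType ℤ K] :
    Finite K := by
  have := Int.isJacobsonRing
  have hfin : Module.Finite ℤ K := finite_of_finite_type_of_isJacobsonRing ℤ K
  obtain ⟨p, hp⟩ := CharP.exists K
  rcases CharP.char_is_prime_or_zero K p with hprime | rfl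
  · refine Module.finite_of_fg_torsion K fun x => ?_
    refine ⟨⟨(p : ℤ), mem_nonZeroDivisors_of_ne_zero (by exact_mod_cast hprime.ne_zero)⟩, ?_⟩
    simp [Submonoid.smul_def]
  · have := CharP.charP_to_charZero K
    exact absurd (isField_of_isIntegral_of_isField
      (FaithfulSMul.algebraMap_injective ℤ K) (Field.toIsField K)) Int.not_isField

/-- A field whose group of units is finitely generated is finite. -/
theorem Field.finite_of_units_fg (K : Type*) [Field K] [Group.FG Kˣ] : Finite K := by
  obtain ⟨s, hs, hfin⟩ := Monoid.fg_iff.1 (inferInstance : Monoid.FG Kˣ)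
  have hadj : Algebra.adjoin ℤ ((fun u : Kˣ => (u : K)) '' s) = ⊤ := by
    refine eq_top_iff.2 fun x _ => ?_
    rcases eq_or_ne x 0 with rfl | hx
    · exact zero_mem _
    · have hle : Submonoid.closure s ≤ (Algebra.adjoin ℤ
          ((fun u : Kˣ => (u : K)) '' s)).toSubmonoid.comap (Units.coeHom K) :=
        Submonoid.closure_le.2 fun u hu => Algebra.subset_adjoin ⟨u, hu, rfl⟩
      exact hle (hs ▸ Submonoid.mem_top (Units.mk0 x hx))
  have : Algebra.FiniteType ℤ K :=
    ⟨Subalgebra.fg_def.2 ⟨_, hfin.image _, hadj⟩⟩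
  exact Field.finite_of_finiteType_int K

/-- A commutative group mapping to a finitely generated commutative group with finite kernel
is finitely generated. -/
theorem CommGroup.fg_of_finite_ker {G Q : Type*} [CommGroup G] [CommGroup Q] [Group.FG Q]
    (φ : G →* Q) (hφ : (φ.ker : Set G).Finite) : Group.FG G := by
  have : Module.Finite ℤ (Additive Q) := Module.Finite.iff_addGroup_fg.2 inferInstance
  let ψ : Additive G →ₗ[ℤ] Additive Q := φ.toAdditive.toIntLinearMap
  have hker : Finite ψ.ker := hφ
  have hfg : Module.Finite ℤ (Additive G) := by
    refine ⟨Submodule.fg_of_fg_map_of_fg_inf_ker ψ (IsNoetherian.noetherian _) ?_⟩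
    rw [top_inf_eq]
    exact Module.Finite.iff_fg.1 inferInstance
  exact GroupFG.iff_add_fg.2 (Module.Finite.iff_addGroup_fg.1 hfg)

/-- Let `k` be an infinite field and `S` a subgroup of `(kˣ)ⁿ` such that the quotient
`(kˣ)ⁿ / S` is finitely generated. Then `S` is Zariski dense in `(kˣ)ⁿ`: every
polynomial over `k` in `n` variables vanishing on `S` vanishes on all of `(kˣ)ⁿ`. -/
theorem subgroup_of_torus_zariski_dense {k : Type*} [Field k] [Infinite k] (n : ℕ)
    (S : Subgroup (Fin n → kˣ)) (hfg : Group.FG ((Fin n → kˣ) ⧸ S))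
    (f : MvPolynomial (Fin n) k)
    (hf : ∀ s ∈ S, MvPolynomial.eval (fun i => (s i : k)) f = 0) :
    ∀ x : Fin n → kˣ, MvPolynomial.eval (fun i => (x i : k)) f = 0 := by
  have hinf (i : Fin n) :
      {t : k | ∃ u : kˣ, (u : k) = t ∧ Pi.mulSingle i u ∈ S}.Infinite := by
    intro hfin
    refine not_finite_iff_infinite.2 ‹Infinite k› ?_
    have : Group.FG kˣ := by
      refine CommGroup.fg_of_finite_ker (Q := (Fin n → kˣ) ⧸ S)
        ((QuotientGroup.mk' S).comp (MonoidHom.mulSingle (fun _ => kˣ) i)) ?_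
      refine (hfin.preimage Units.val_injective.injOn).subset fun u hu => ⟨u, rfl, ?_⟩
      exact (QuotientGroup.eq_one_iff _).1 hu
    exact Field.finite_of_units_fg k
  have hzero : f = 0 := by
    refine MvPolynomial.funext_set _ hinf fun x hx => ?_
    choose u hu hS using fun i => hx i (Set.mem_univ i)
    have hmem : u ∈ S := by
      rw [← Finset.univ_prod_mulSingle u]
      exact Subgroup.prod_mem S fun i _ => hS i
    rw [← funext hu, hf u hmem, map_zero]
  simp [hzero]
end

section
/- Let k be a field of characteristic 0, let n ≥ 1, and let g ∈ GLₙ(k) be a nontrivial unipotent element, i.e. g ≠ 1 and g − 1 is a nilpotent matrix. Then there exist a group homomorphism φ : SL₂(k) → GLₙ(k) and a unipotent element u ∈ SL₂(k) (i.e. u − 1 nilpotent) such that φ(u) = g. -/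
open Polynomial DirectSum

/-- The elementary unipotent element `!![1, 1; 0, 1]` of `SL₂(k)`. -/
def upperUnipotent (k : Type*) [CommRing k] : Matrix.SpecialLinearGroup (Fin 2) k :=
  ⟨!![1, 1; 0, 1], by simp [Matrix.det_fin_two]⟩

/-- A `k[X]`-module `M` is an `SL₂`-module if `SL₂(k)` acts `k`-linearly on `M` in such a way that
`upperUnipotent k` acts as `1 + X`. -/
def HasSL2Action (k M : Type*) [Field k] [AddCommGroup M] [Module k M] [Module k[X] M] : Prop :=
  ∃ ρ : Representation k (Matrix.SpecialLinearGroup (Fin 2) k) M,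
    ∀ m : M, ρ (upperUnipotent k) m = m + (X : k[X]) • m

namespace HasSL2Action

variable {k : Type*} [Field k]

theorem of_subsingleton {M : Type*} [AddCommGroup M] [Module k M] [Module k[X] M]
    [Subsingleton M] : HasSL2Action k M :=
  ⟨1, fun _ ↦ Subsingleton.elim _ _⟩

theorem of_equiv {M N : Type*} [AddCommGroup M] [Module k M] [Module k[X] M]
    [IsScalarTower k k[X] M] [AddCommGroup N] [Module k N] [Module k[X] N]
    [IsScalarTower k k[X] N] (h : HasSL2Action k M) (e : M ≃ₗ[k[X]] N) : HasSL2Action k N := by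
  obtain ⟨ρ, hρ⟩ := h
  refine ⟨(e.restrictScalars k).conjAlgEquiv k |>.toMonoidHom.comp ρ, fun m ↦ ?_⟩
  change e (ρ (upperUnipotent k) (e.symm m)) = _
  simp [hρ]

theorem directSum {ι : Type*} {M : ι → Type*} [∀ i, AddCommGroup (M i)]
    [∀ i, Module k (M i)] [∀ i, Module k[X] (M i)] (h : ∀ i, HasSL2Action k (M i)) :
    HasSL2Action k (⨁ i, M i) := by
  choose ρ hρ using h
  refine ⟨⟨⟨fun g ↦ DirectSum.lmap fun i ↦ ρ i g, ?_⟩, fun g h ↦ ?_⟩, fun m ↦ ?_⟩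
  · ext; simp
  · ext; simp
  · refine DFinsupp.ext fun i ↦ ?_
    change ρ i (upperUnipotent k) (m i) = m i + (X : k[X]) • m i
    exact hρ i _

end HasSL2Action

/-- A `k[X]`-module of `k`-dimension at most `d + 1` containing an element killed by `X ^ (d + 1)`
but not by `X ^ d` is isomorphic to `k[X] / (X ^ (d + 1))`. -/
theorem nonempty_equiv_quotient_X_pow {k M : Type*} [Field k] [AddCommGroup M] [Module k M]
    [Module k[X] M] [IsScalarTower k k[X] M] [FiniteDimensional k M] {d : ℕ}
    (hd : Module.finrank k M ≤ d + 1) {v : M} (hv : (X : k[X]) ^ d • v ≠ 0)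
    (hv' : (X : k[X]) ^ (d + 1) • v = 0) :
    Nonempty ((k[X] ⧸ k[X] ∙ (X : k[X]) ^ (d + 1)) ≃ₗ[k[X]] M) := by
  let f := LinearMap.toSpanSingleton k[X] M v
  have hker : LinearMap.ker f = k[X] ∙ (X : k[X]) ^ (d + 1) := by
    obtain ⟨q, hq⟩ := (inferInstance : (LinearMap.ker f).IsPrincipal)
    have hqX : q ∣ X ^ (d + 1) := by
      rw [← Ideal.mem_span_singleton, ← Ideal.submodule_span_eq, ← hq]
      simpa [f] using hv'
    obtain ⟨i, hi, hqi⟩ := (dvd_prime_pow prime_X _).1 hqX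
    have hspan : k[X] ∙ q = k[X] ∙ (X : k[X]) ^ i :=
      Ideal.span_singleton_eq_span_singleton.2 hqi
    rw [hq, hspan]
    obtain rfl : i = d + 1 := by
      refine le_antisymm hi (not_lt.1 fun hlt ↦ hv ?_)
      have : (X : k[X]) ^ d ∈ LinearMap.ker f := by
        rw [hq, hspan, Ideal.submodule_span_eq, Ideal.mem_span_singleton]
        exact pow_dvd_pow _ (Nat.lt_succ_iff.1 hlt)
      simpa [f] using this
    rfl
  let e : (k[X] ⧸ k[X] ∙ (X : k[X]) ^ (d + 1)) →ₗ[k[X]] M := Submodule.liftQ _ f hker.ge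
  have hinj : Function.Injective e :=
    LinearMap.ker_eq_bot.1 (Submodule.ker_liftQ_eq_bot _ _ _ hker.le)
  have hfin : Module.finrank k (k[X] ⧸ k[X] ∙ (X : k[X]) ^ (d + 1)) = d + 1 := by
    simpa using finrank_quotient_span_eq_natDegree (f := (X : k[X]) ^ (d + 1))
  have hinj' : Function.Injective (e.restrictScalars k) := hinj
  have : FiniteDimensional k (k[X] ⧸ k[X] ∙ (X : k[X]) ^ (d + 1)) :=
    FiniteDimensional.of_injective _ hinj'
  have hle := LinearMap.finrank_le_finrank_of_injective hinj'
  have hsurj := (LinearMap.injective_iff_surjective_of_finrank_eq_finrank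
    (f := e.restrictScalars k) (by omega)).1 hinj'
  exact ⟨LinearEquiv.ofBijective e ⟨hinj, hsurj⟩⟩

section BinaryForms

open MvPolynomial (homogeneousSubmodule)

variable {k : Type*} [Field k]

/-- The linear substitution of variables in a polynomial in two variables given by a matrix. -/
noncomputable def binarySubst (A : Matrix (Fin 2) (Fin 2) k) :
    MvPolynomial (Fin 2) k →ₐ[k] MvPolynomial (Fin 2) k :=
  MvPolynomial.aeval fun i ↦ ∑ j, MvPolynomial.C (A j i) * MvPolynomial.X j

theorem binarySubst_one : binarySubst (1 : Matrix (Fin 2) (Fin 2) k) = AlgHom.id k _ := by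
  refine MvPolynomial.algHom_ext fun i ↦ ?_
  fin_cases i <;> simp [binarySubst]

theorem binarySubst_mul (A B : Matrix (Fin 2) (Fin 2) k) :
    binarySubst (A * B) = (binarySubst A).comp (binarySubst B) := by
  refine MvPolynomial.algHom_ext fun i ↦ ?_
  simp only [binarySubst, MvPolynomial.aeval_X, Matrix.mul_apply, Fin.sum_univ_two, map_add,
    map_mul, AlgHom.comp_apply, MvPolynomial.algHom_C, MvPolynomial.algebraMap_eq]
  ring

/-- The action of `SL₂(k)` on polynomials in two variables by linear substitutions. -/
noncomputable def binaryPolynomialRep (k : Type*) [Field k] :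
    Representation k (Matrix.SpecialLinearGroup (Fin 2) k) (MvPolynomial (Fin 2) k) where
  toFun A := (binarySubst (A : Matrix (Fin 2) (Fin 2) k)).toLinearMap
  map_one' := by
    rw [Matrix.SpecialLinearGroup.coe_one, binarySubst_one]
    rfl
  map_mul' A B := by
    rw [Matrix.SpecialLinearGroup.coe_mul, binarySubst_mul]
    rfl

theorem binaryPolynomialRep_apply (A : Matrix.SpecialLinearGroup (Fin 2) k)
    (f : MvPolynomial (Fin 2) k) :
    binaryPolynomialRep k A f = binarySubst (A : Matrix (Fin 2) (Fin 2) k) f := rfl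

theorem binaryPolynomialRep_upperUnipotent_X_zero :
    binaryPolynomialRep k (upperUnipotent k) (MvPolynomial.X 0) = MvPolynomial.X 0 := by
  rw [binaryPolynomialRep_apply]
  simp [binarySubst, upperUnipotent]

theorem binaryPolynomialRep_upperUnipotent_X_one :
    binaryPolynomialRep k (upperUnipotent k) (MvPolynomial.X 1) =
      MvPolynomial.X 1 + MvPolynomial.X 0 := by
  rw [binaryPolynomialRep_apply]
  simp [binarySubst, upperUnipotent, add_comm]

theorem binaryPolynomialRep_mem_homogeneousSubmodule {d : ℕ} {f : MvPolynomial (Fin 2) k}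
    (A : Matrix.SpecialLinearGroup (Fin 2) k) (hf : f ∈ homogeneousSubmodule (Fin 2) k d) :
    binaryPolynomialRep k A f ∈ homogeneousSubmodule (Fin 2) k d := by
  rw [MvPolynomial.mem_homogeneousSubmodule] at hf ⊢
  simpa [binaryPolynomialRep_apply, binarySubst] using hf.aeval (n := 1)
    (fun i ↦ ∑ j, MvPolynomial.C (A j i) * MvPolynomial.X j) fun i ↦ MvPolynomial.IsHomogeneous.sum _ _ _ fun j _ ↦ MvPolynomial.isHomogeneous_C_mul_X _ _

/-- The action of `SL₂(k)` on binary forms of degree `d`. -/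
noncomputable def binaryFormRep (k : Type*) [Field k] (d : ℕ) :
    Representation k (Matrix.SpecialLinearGroup (Fin 2) k) (homogeneousSubmodule (Fin 2) k d) where
  toFun A := (binaryPolynomialRep k A).restrict
    fun _ hf ↦ binaryPolynomialRep_mem_homogeneousSubmodule A hf
  map_one' := by ext; simp [LinearMap.restrict_apply]
  map_mul' A B := by ext; simp [LinearMap.restrict_apply]

theorem coe_binaryFormRep_apply {d : ℕ} (A : Matrix.SpecialLinearGroup (Fin 2) k)
    (f : homogeneousSubmodule (Fin 2) k d) :
    (binaryFormRep k d A f : MvPolynomial (Fin 2) k) = binaryPolynomialRep k A f := rfl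

theorem homogeneousSubmodule_fin_two_le_span (d : ℕ) :
    homogeneousSubmodule (Fin 2) k d ≤ Submodule.span k (Set.range fun i : Fin (d + 1) ↦
      (MvPolynomial.X 0 ^ (i : ℕ) * MvPolynomial.X 1 ^ (d - i) : MvPolynomial (Fin 2) k)) := by
  intro f hf
  rw [MvPolynomial.mem_homogeneousSubmodule] at hf
  rw [f.as_sum]
  refine Submodule.sum_mem _ fun s hs ↦ ?_
  have hsd : s 0 + s 1 = d := by
    rw [hf.degree_eq_sum_deg_support hs, ← Finsupp.degree_apply, Finsupp.degree_eq_sum,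
      Fin.sum_univ_two]
  rw [MvPolynomial.monomial_eq, ← MvPolynomial.smul_eq_C_mul]
  refine Submodule.smul_mem _ _ (Submodule.subset_span ⟨⟨s 0, by omega⟩, ?_⟩)
  rw [Finsupp.prod_fintype _ _ (by simp), Fin.prod_univ_two]
  simp [← hsd]

instance finiteDimensional_homogeneousSubmodule_fin_two (d : ℕ) :
    FiniteDimensional k (homogeneousSubmodule (Fin 2) k d) :=
  have := FiniteDimensional.span_of_finite k (Set.finite_range fun i : Fin (d + 1) ↦
    (MvPolynomial.X 0 ^ (i : ℕ) * MvPolynomial.X 1 ^ (d - i) : MvPolynomial (Fin 2) k))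
  Submodule.finiteDimensional_of_le (homogeneousSubmodule_fin_two_le_span d)

theorem finrank_homogeneousSubmodule_fin_two_le (d : ℕ) :
    Module.finrank k (homogeneousSubmodule (Fin 2) k d) ≤ d + 1 := by
  have := FiniteDimensional.span_of_finite k (Set.finite_range fun i : Fin (d + 1) ↦
    (MvPolynomial.X 0 ^ (i : ℕ) * MvPolynomial.X 1 ^ (d - i) : MvPolynomial (Fin 2) k))
  refine (Submodule.finrank_mono (homogeneousSubmodule_fin_two_le_span d)).trans ?_
  simpa [Set.finrank] using finrank_range_le_card (R := k) fun i : Fin (d + 1) ↦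
    (MvPolynomial.X 0 ^ (i : ℕ) * MvPolynomial.X 1 ^ (d - i) : MvPolynomial (Fin 2) k)

theorem binaryPolynomialRep_upperUnipotent_sub_one_X_zero_pow_mul (a j : ℕ)
    (f : MvPolynomial (Fin 2) k) :
    ((binaryPolynomialRep k (upperUnipotent k) - 1) ^ j) (MvPolynomial.X 0 ^ a * f) =
      MvPolynomial.X 0 ^ a * ((binaryPolynomialRep k (upperUnipotent k) - 1) ^ j) f := by
  induction j generalizing f with
  | zero => simp
  | succ j ih =>
    rw [pow_succ, Module.End.mul_apply, Module.End.mul_apply, ← ih]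
    congr 1
    rw [LinearMap.sub_apply, LinearMap.sub_apply, binaryPolynomialRep_apply, map_mul, map_pow,
      ← binaryPolynomialRep_apply, binaryPolynomialRep_upperUnipotent_X_zero, mul_sub]
    rfl

theorem binaryPolynomialRep_upperUnipotent_sub_one_X_one_pow (i : ℕ) :
    (binaryPolynomialRep k (upperUnipotent k) - 1) (MvPolynomial.X 1 ^ i) =
      ∑ l ∈ Finset.range i,
        (i.choose l : k) • (MvPolynomial.X 0 ^ (i - l) * MvPolynomial.X 1 ^ l) := by
  have h : binaryPolynomialRep k (upperUnipotent k) (MvPolynomial.X 1 ^ i) =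
      (MvPolynomial.X 1 + MvPolynomial.X 0) ^ i := by
    rw [binaryPolynomialRep_apply, map_pow, ← binaryPolynomialRep_apply,
      binaryPolynomialRep_upperUnipotent_X_one]
  rw [LinearMap.sub_apply, h, add_pow, Finset.sum_range_succ]
  simp only [Nat.choose_self, tsub_self, pow_zero, mul_one, Nat.cast_one, Module.End.one_apply,
    add_sub_cancel_right, MvPolynomial.smul_eq_C_mul, map_natCast]
  exact Finset.sum_congr rfl fun l _ ↦ by ring

theorem binaryPolynomialRep_upperUnipotent_sub_one_pow_X_one_pow_of_lt {i j : ℕ} (h : i < j) :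
    ((binaryPolynomialRep k (upperUnipotent k) - 1) ^ j) (MvPolynomial.X 1 ^ i) = 0 := by
  induction j generalizing i with
  | zero => omega
  | succ j ih =>
    rw [pow_succ, Module.End.mul_apply, binaryPolynomialRep_upperUnipotent_sub_one_X_one_pow,
      map_sum]
    refine Finset.sum_eq_zero fun l hl ↦ ?_
    have := Finset.mem_range.1 hl
    rw [map_smul, binaryPolynomialRep_upperUnipotent_sub_one_X_zero_pow_mul, ih (by omega)]
    simp

theorem binaryPolynomialRep_upperUnipotent_sub_one_pow_X_one_pow_self (j : ℕ) :
    ((binaryPolynomialRep k (upperUnipotent k) - 1) ^ j) (MvPolynomial.X 1 ^ j) =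
      (j.factorial : k) • MvPolynomial.X 0 ^ j := by
  induction j with
  | zero => simp
  | succ j ih =>
    rw [pow_succ, Module.End.mul_apply, binaryPolynomialRep_upperUnipotent_sub_one_X_one_pow,
      map_sum, Finset.sum_range_succ, Finset.sum_eq_zero fun l hl ↦ ?_]
    · rw [map_smul, binaryPolynomialRep_upperUnipotent_sub_one_X_zero_pow_mul, ih]
      simp [Nat.factorial_succ, MvPolynomial.smul_eq_C_mul]
      ring
    · have := Finset.mem_range.1 hl
      rw [map_smul, binaryPolynomialRep_upperUnipotent_sub_one_X_zero_pow_mul,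
        binaryPolynomialRep_upperUnipotent_sub_one_pow_X_one_pow_of_lt this]
      simp

theorem coe_binaryFormRep_sub_one_pow_apply {d : ℕ} (A : Matrix.SpecialLinearGroup (Fin 2) k)
    (j : ℕ) (f : homogeneousSubmodule (Fin 2) k d) :
    (((binaryFormRep k d A - 1) ^ j) f : MvPolynomial (Fin 2) k) =
      ((binaryPolynomialRep k A - 1) ^ j) f := by
  induction j generalizing f with
  | zero => simp
  | succ j ih =>
    rw [pow_succ, pow_succ, Module.End.mul_apply, Module.End.mul_apply, ih]
    rfl

/-- The binary forms of degree `d` realise a single unipotent Jordan block of size `d + 1`. -/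
theorem hasSL2Action_quotient_X_pow_succ [CharZero k] (d : ℕ) :
    HasSL2Action k (k[X] ⧸ k[X] ∙ (X : k[X]) ^ (d + 1)) := by
  let N : Module.End k (homogeneousSubmodule (Fin 2) k d) :=
    binaryFormRep k d (upperUnipotent k) - 1
  let v : homogeneousSubmodule (Fin 2) k d :=
    ⟨MvPolynomial.X 1 ^ d, MvPolynomial.isHomogeneous_X_pow 1 d⟩
  let of := Module.AEval.of k (homogeneousSubmodule (Fin 2) k d) N
  have hv : (X : k[X]) ^ d • of v ≠ 0 := by
    rw [Module.AEval.X_pow_smul_of, (LinearEquiv.map_ne_zero_iff _), ne_eq, ← Subtype.coe_inj]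
    change ((N ^ d) v : MvPolynomial (Fin 2) k) ≠ 0
    rw [coe_binaryFormRep_sub_one_pow_apply,
      binaryPolynomialRep_upperUnipotent_sub_one_pow_X_one_pow_self]
    exact smul_ne_zero (Nat.cast_ne_zero.2 d.factorial_ne_zero)
      (pow_ne_zero _ (MvPolynomial.X_ne_zero _))
  have hv' : (X : k[X]) ^ (d + 1) • of v = 0 := by
    rw [Module.AEval.X_pow_smul_of, (LinearEquiv.map_eq_zero_iff _), ← Subtype.coe_inj]
    change ((N ^ (d + 1)) v : MvPolynomial (Fin 2) k) = 0
    rw [coe_binaryFormRep_sub_one_pow_apply]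
    exact binaryPolynomialRep_upperUnipotent_sub_one_pow_X_one_pow_of_lt d.lt_succ_self
  have : Module.Finite k (Module.AEval k (homogeneousSubmodule (Fin 2) k d) N) := inferInstance
  have hd : Module.finrank k (Module.AEval k (homogeneousSubmodule (Fin 2) k d) N) ≤ d + 1 :=
    finrank_homogeneousSubmodule_fin_two_le d
  obtain ⟨e⟩ := nonempty_equiv_quotient_X_pow
    (M := Module.AEval k (homogeneousSubmodule (Fin 2) k d) N) hd hv hv'
  have hN : HasSL2Action k (Module.AEval k (homogeneousSubmodule (Fin 2) k d) N) := by
    refine ⟨(of.conjAlgEquiv k).toMonoidHom.comp (binaryFormRep k d), fun m ↦ ?_⟩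
    obtain ⟨m, rfl⟩ := of.surjective m
    rw [Module.AEval.X_smul_of, ← map_add]
    change of (binaryFormRep k d (upperUnipotent k) (of.symm (of m))) = _
    simp [N, of]
  exact hN.of_equiv e.symm

theorem hasSL2Action_quotient_X_pow [CharZero k] :
    ∀ m : ℕ, HasSL2Action k (k[X] ⧸ k[X] ∙ (X : k[X]) ^ m)
  | 0 =>
    have : Subsingleton (k[X] ⧸ k[X] ∙ (X : k[X]) ^ 0) :=
      Submodule.Quotient.subsingleton_iff.2 (by simp)
    .of_subsingleton
  | d + 1 => hasSL2Action_quotient_X_pow_succ d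

end BinaryForms

theorem hasSL2Action_aeval_of_isNilpotent {k V : Type*} [Field k] [CharZero k] [AddCommGroup V]
    [Module k V] [FiniteDimensional k V] {N : Module.End k V} (hN : IsNilpotent N) :
    HasSL2Action k (Module.AEval k V N) := by
  obtain ⟨r, hr⟩ := hN
  have htors : Module.IsTorsion' (Module.AEval k V N) (Submonoid.powers (X : k[X])) := by
    rw [Submodule.isTorsion'_powers_iff]
    refine fun x ↦ ⟨r, ?_⟩
    obtain ⟨x, rfl⟩ := (Module.AEval.of k V N).surjective x
    rw [Module.AEval.X_pow_smul_of, hr, zero_smul, map_zero]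
  obtain ⟨s, m, ⟨e⟩⟩ := Module.torsion_by_prime_power_decomposition irreducible_X htors
  exact (HasSL2Action.directSum fun i ↦ hasSL2Action_quotient_X_pow (m i)).of_equiv e.symm

/-- In characteristic zero every unipotent endomorphism of a finite-dimensional space is the image
of `upperUnipotent k` under some representation of `SL₂(k)`. -/
theorem exists_representation_upperUnipotent_eq {k V : Type*} [Field k] [CharZero k]
    [AddCommGroup V] [Module k V] [FiniteDimensional k V] {f : Module.End k V}
    (hf : IsNilpotent (f - 1)) :
    ∃ ρ : Representation k (Matrix.SpecialLinearGroup (Fin 2) k) V,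
      ρ (upperUnipotent k) = f := by
  obtain ⟨ρ, hρ⟩ := hasSL2Action_aeval_of_isNilpotent hf
  let of := Module.AEval.of k V (f - 1)
  refine ⟨(of.symm.conjAlgEquiv k).toMonoidHom.comp ρ, LinearMap.ext fun v ↦ ?_⟩
  change of.symm (ρ (upperUnipotent k) (of v)) = f v
  rw [hρ, Module.AEval.X_smul_of, ← map_add]
  simp [of]


/-- Let `k` be a field of characteristic 0, `n ≥ 1`, and `g ∈ GLₙ(k)` a nontrivial
unipotent element. Then there is a group homomorphism `φ : SL₂(k) → GLₙ(k)` and a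
unipotent `u ∈ SL₂(k)` with `φ(u) = g`. -/
theorem exists_sl2_hom_of_unipotent {k : Type*} [Field k] [CharZero k]
    (n : ℕ) (hn : 1 ≤ n) (g : GL (Fin n) k) (hg : g ≠ 1)
    (hgu : IsNilpotent ((g : Matrix (Fin n) (Fin n) k) - 1)) :
    ∃ (φ : Matrix.SpecialLinearGroup (Fin 2) k →* GL (Fin n) k)
      (u : Matrix.SpecialLinearGroup (Fin 2) k),
      IsNilpotent ((u : Matrix (Fin 2) (Fin 2) k) - 1) ∧ φ u = g := by
  have hf : IsNilpotent (Matrix.toLinAlgEquiv' (g : Matrix (Fin n) (Fin n) k) - 1) := by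
    simpa using hgu.map (Matrix.toLinAlgEquiv' (R := k) (n := Fin n))
  obtain ⟨ρ, hρ⟩ := exists_representation_upperUnipotent_eq hf
  refine ⟨(Units.map (LinearMap.toMatrixAlgEquiv' (R := k) (n := Fin n)).toMonoidHom).comp
    ρ.toHomUnits, upperUnipotent k, ⟨2, ?_⟩, Units.ext ?_⟩
  · ext i j
    fin_cases i <;> fin_cases j <;> simp [upperUnipotent, pow_two, Matrix.mul_apply]
  · change LinearMap.toMatrixAlgEquiv' (ρ (upperUnipotent k)) = _
    rw [hρ, LinearMap.toMatrixAlgEquiv'_toLinAlgEquiv']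
end
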